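/- Let α > 0, a > 0 and R > 0 with R^α < a. If U is a random point uniformly distributed on the closed disk of radius R centered at the origin in ℝ², then E[1/(1 + a‖U‖^{−α})] = (2/R²) ∫_0^R r/(1 + a r^{−α}) dr = (2 R^α)/(a(2+α)) · ₂F₁(1, 1 + 2/α; 2 + 2/α; −R^α/a), where ₂F₁ is the Gauss hypergeometric function. (This is the closed-form evaluation of the CoMP-interference factor averaged over the uniformly distributed base-station location, appearing in Theorem 1 of the paper.) -/

import Mathlib

open MeasureTheory ProbabilityTheory Real

/-- The Gauss (ordinary) hypergeometric function `₂F₁(a, b; c; x)`, given for `|x| < 1` by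
`Σ_{k≥0} (a)_k (b)_k / (c)_k · x^k / k!`, where `(q)_k` is the rising Pochhammer symbol. -/
noncomputable def hyp2F1 (a b c x : ℝ) : ℝ :=
  ∑' k : ℕ,
    (Polynomial.eval a (ascPochhammer ℝ k) * Polynomial.eval b (ascPochhammer ℝ k) /
        Polynomial.eval c (ascPochhammer ℝ k)) * x ^ k / (k.factorial : ℝ)

open Set in
/-- Integration in polar coordinates of a radial function over a disk in the Euclidean plane. -/
theorem setIntegral_closedBall_fun_norm_fin_two (f : ℝ → ℝ) {R : ℝ} (hR : 0 ≤ R) :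
    ∫ x in Metric.closedBall (0 : EuclideanSpace ℝ (Fin 2)) R, f ‖x‖ =
      2 * π * ∫ r in (0 : ℝ)..R, r * f r := by
  have hind : (Metric.closedBall (0 : EuclideanSpace ℝ (Fin 2)) R).indicator (fun x => f ‖x‖) =
      fun x => (Iic R).indicator f ‖x‖ := by
    ext x
    simp [indicator]
  rw [← integral_indicator Metric.isClosed_closedBall.measurableSet, hind,
    integral_fun_norm_addHaar volume ((Iic R).indicator f), intervalIntegral.integral_of_le hR]
  have hsmul : (fun y : ℝ => y ^ (Module.finrank ℝ (EuclideanSpace ℝ (Fin 2)) - 1) •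
      (Iic R).indicator f y) = (Iic R).indicator fun y => y * f y := by
    ext y
    by_cases hy : y ≤ R <;> simp [indicator, hy]
  rw [hsmul, setIntegral_indicator measurableSet_Iic, Ioi_inter_Iic, Measure.real,
    EuclideanSpace.volume_ball_fin_two]
  simp [Real.pi_nonneg, mul_assoc]

/-- The mean of a radial function of a uniformly distributed point of a disk in the plane. -/
theorem integral_fun_norm_of_map_eq_uniform_closedBall {Ω : Type*} [MeasurableSpace Ω]
    {μ : Measure Ω} {U : Ω → EuclideanSpace ℝ (Fin 2)} (hUm : AEMeasurable U μ) {R : ℝ}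
    (hR : 0 < R)
    (hU : μ.map U = (volume (Metric.closedBall (0 : EuclideanSpace ℝ (Fin 2)) R))⁻¹ •
      volume.restrict (Metric.closedBall 0 R)) {f : ℝ → ℝ} (hf : Measurable f) :
    ∫ ω, f ‖U ω‖ ∂μ = 2 / R ^ 2 * ∫ r in (0 : ℝ)..R, r * f r := by
  have hmap := integral_map hUm (f := fun x => f ‖x‖)
    (hf.comp measurable_norm).aestronglyMeasurable
  rw [← hmap, hU, integral_smul_measure, setIntegral_closedBall_fun_norm_fin_two f hR.le,
    EuclideanSpace.volume_closedBall_fin_two]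
  simp only [ENNReal.toReal_inv, ENNReal.toReal_mul, ENNReal.toReal_pow,
    ENNReal.toReal_ofReal hR.le, ENNReal.toReal_ofReal Real.pi_nonneg, smul_eq_mul]
  field_simp

theorem ascPochhammer_eval_mul_add {S : Type*} [CommSemiring S] (b : S) (k : ℕ) :
    (ascPochhammer S k).eval b * (b + k) = b * (ascPochhammer S k).eval (b + 1) := by
  induction k with
  | zero => simp
  | succ k ih =>
    rw [ascPochhammer_succ_eval, ih, ascPochhammer_succ_eval]
    push_cast
    ring

theorem hyp2F1_one_self_add_one {b : ℝ} (hb : 0 < b) (x : ℝ) :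
    hyp2F1 1 b (b + 1) x = ∑' k : ℕ, b / (b + k) * x ^ k := by
  refine tsum_congr fun k => ?_
  have hpos := ascPochhammer_pos k (b + 1) (by positivity)
  have hk : (k.factorial : ℝ) ≠ 0 := by positivity
  have hbk : b + k ≠ 0 := by positivity
  have hrec := ascPochhammer_eval_mul_add b k
  rw [ascPochhammer_eval_one]
  field_simp
  linear_combination x ^ k * hrec

/-- Termwise integration of the geometric expansion of `r / (1 + a r ^ (-α))`. -/
theorem hasSum_integral_div_one_add_mul_rpow_neg {α a R : ℝ} (hα : 0 < α) (ha : 0 < a)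
    (hR : 0 < R) (hRa : R ^ α < a) :
    HasSum (fun k : ℕ => R ^ 2 * (R ^ α / a) * ((-(R ^ α) / a) ^ k / (2 + (k + 1) * α)))
      (∫ r in (0 : ℝ)..R, r / (1 + a * r ^ (-α))) := by
  have hratio : R ^ α / a < 1 := (div_lt_one ha).2 hRa
  have hexp (k : ℕ) {t : ℝ} (ht : 0 < t) :
      t ^ (1 + (k + 1) * α) = t * (t ^ α * (t ^ α) ^ k) := by
    rw [Real.rpow_add ht, Real.rpow_one, mul_comm _ α, Real.rpow_mul ht.le, ← pow_succ',
      ← Real.rpow_natCast]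
    push_cast
    rfl
  have hsum := intervalIntegral.hasSum_integral_of_dominated_convergence (μ := volume)
    (a := 0) (b := R) (F := fun (k : ℕ) t => a⁻¹ * (-a⁻¹) ^ k * t ^ (1 + (k + 1) * α))
    (f := fun r => r / (1 + a * r ^ (-α)))
    (fun k _ => R * (R ^ α / a) * (R ^ α / a) ^ k)
    (fun k => (by fun_prop : Measurable _).aestronglyMeasurable)
    (fun k => .of_forall fun t ht => ?_)
    (.of_forall fun t _ =>
      (summable_geometric_of_lt_one (by positivity) hratio).mul_left _)
    intervalIntegrable_const
    (.of_forall fun t ht => ?_)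
  · refine hsum.congr_fun fun k => ?_
    rw [intervalIntegral.integral_const_mul,
      integral_rpow (.inl (by nlinarith [mul_pos (k.cast_add_one_pos (α := ℝ)) hα])),
      Real.zero_rpow (by positivity), Real.rpow_add hR, hexp k hR, Real.rpow_one, neg_div,
      neg_pow (R ^ α / a), neg_pow a⁻¹, inv_pow, div_pow]
    have : (2 : ℝ) + (k + 1) * α ≠ 0 := by positivity
    have : (1 : ℝ) + (k + 1) * α + 1 ≠ 0 := by positivity
    field_simp
    ring
  · rw [Set.uIoc_of_le hR.le] at ht
    have ht0 := ht.1
    have htR : t ^ α ≤ R ^ α := Real.rpow_le_rpow ht0.le ht.2 hα.le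
    rw [hexp k ht0, norm_mul, norm_mul, norm_pow, norm_neg, Real.norm_of_nonneg (by positivity),
      Real.norm_of_nonneg (by positivity)]
    calc a⁻¹ * a⁻¹ ^ k * (t * (t ^ α * (t ^ α) ^ k))
        ≤ a⁻¹ * a⁻¹ ^ k * (R * (R ^ α * (R ^ α) ^ k)) := by
          gcongr
          exact ht.2
      _ = R * (R ^ α / a) * (R ^ α / a) ^ k := by
          rw [div_eq_mul_inv, mul_pow]
          ring
  · rw [Set.uIoc_of_le hR.le] at ht
    have ht0 := ht.1
    have htR : t ^ α ≤ R ^ α := Real.rpow_le_rpow ht0.le ht.2 hα.le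
    have htα : 0 < t ^ α := Real.rpow_pos_of_pos ht0 α
    have hgeom := (hasSum_geometric_of_abs_lt_one (r := -(t ^ α / a)) (by
      rw [abs_neg, abs_of_pos (by positivity), div_lt_one ha]
      exact htR.trans_lt hRa)).mul_left (t * (t ^ α / a))
    have hval : t / (1 + a * t ^ (-α)) = t * (t ^ α / a) * (1 - -(t ^ α / a))⁻¹ := by
      rw [Real.rpow_neg ht0.le, sub_neg_eq_add]
      have : t ^ α + a ≠ 0 := by positivity
      field_simp
      ring
    rw [hval]
    refine hgeom.congr_fun fun k => ?_
    rw [hexp k ht0, neg_pow, neg_pow (t ^ α / a), inv_pow, div_pow]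
    field_simp

/-- For `α > 0`, `a > 0`, `0 < R` with `R^α < a`, if `U` is uniform on the closed disk of
radius `R` in ℝ², then
`E[1/(1 + a‖U‖^{−α})] = (2/R²) ∫_0^R r/(1 + a r^{−α}) dr
  = (2R^α)/(a(2+α)) ₂F₁(1, 1+2/α; 2+2/α; −R^α/a)`. -/
theorem stmt_6 {Ω : Type*} [MeasureSpace Ω] [IsProbabilityMeasure (ℙ : Measure Ω)]
    (α a R : ℝ) (hα : 0 < α) (ha : 0 < a) (hR : 0 < R) (hRa : R ^ α < a)
    (U : Ω → EuclideanSpace ℝ (Fin 2)) (hUm : Measurable U)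
    (hU : Measure.map U ℙ =
      (volume (Metric.closedBall (0 : EuclideanSpace ℝ (Fin 2)) R))⁻¹ •
        volume.restrict (Metric.closedBall 0 R)) :
    ((∫ ω, 1 / (1 + a * ‖U ω‖ ^ (-α)) ∂ℙ) =
        (2 / R ^ 2) * (∫ r in (0 : ℝ)..R, r / (1 + a * r ^ (-α)))) ∧
      ((2 / R ^ 2) * (∫ r in (0 : ℝ)..R, r / (1 + a * r ^ (-α))) =
        (2 * R ^ α) / (a * (2 + α)) * hyp2F1 1 (1 + 2 / α) (2 + 2 / α) (-(R ^ α) / a)) := by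
  refine ⟨?_, ?_⟩
  · have hmean := integral_fun_norm_of_map_eq_uniform_closedBall hUm.aemeasurable hR hU
      (f := fun r => 1 / (1 + a * r ^ (-α))) (by fun_prop)
    simpa only [mul_one_div] using hmean
  · have hc : 2 + 2 / α = 1 + 2 / α + 1 := by ring
    rw [hc, hyp2F1_one_self_add_one (by positivity),
      ← (hasSum_integral_div_one_add_mul_rpow_neg hα ha hR hRa).tsum_eq, ← tsum_mul_left,
      ← tsum_mul_left]
    refine tsum_congr fun k => ?_
    have : (2 : ℝ) + (k + 1) * α ≠ 0 := by positivity
    have : 1 + 2 / α + k ≠ 0 := by positivity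
    have : α + 2 + k * α ≠ 0 := by positivity
    field_simp
    ring
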